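/- (Symplectic half-flat structure on the solvable Lie algebra s₁, giving solutions of the SUSY equations IIA.) The 2-form F̂ = β¹² + β³⁴ + β⁵⁶ is closed, dF̂ = 0, and the complex 3-form Ψ̂ = (β¹ + iβ²)∧(β³ + iβ⁴)∧(β⁵ + iβ⁶) satisfies d(Re Ψ̂) = 0. Hence (F̂, Ψ̂) is a symplectic half-flat SU(3) structure on s₁ whose (1,0)-form α̂ = β¹ + iβ² has closed real part. -/

import Mathlib

noncomputable section

/-- `Λ`, the exterior algebra over `ℝ` on six degree-one generators. -/
abbrev Lam : Type := ExteriorAlgebra ℝ (Fin 6 → ℝ)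

/-- The six degree-one generators (indexed from `0`, so `β 0` is the paper's `β¹`
or `e¹`, …, `β 5` is `β⁶` or `e⁶`). -/
def β (i : Fin 6) : Lam := ExteriorAlgebra.ι ℝ (Pi.single i 1)

/-- The real part of the product `(x₁ + i y₁) ∧ (x₂ + i y₂) ∧ (x₃ + i y₃)` of
complex-coefficient forms in `Λ ⊗ ℂ`, expressed in terms of real forms. -/
def reProd3 (x₁ y₁ x₂ y₂ x₃ y₃ : Lam) : Lam :=
  x₁ * x₂ * x₃ - x₁ * y₂ * y₃ - y₁ * x₂ * y₃ - y₁ * y₂ * x₃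

/-- The imaginary part of the product `(x₁ + i y₁) ∧ (x₂ + i y₂) ∧ (x₃ + i y₃)` of
complex-coefficient forms in `Λ ⊗ ℂ`, expressed in terms of real forms. -/
def imProd3 (x₁ y₁ x₂ y₂ x₃ y₃ : Lam) : Lam :=
  x₁ * x₂ * y₃ + x₁ * y₂ * x₃ + y₁ * x₂ * x₃ - y₁ * y₂ * y₃

/-- The graded Leibniz rule: `d (x ∧ y) = dx ∧ y + (-1)^p x ∧ dy` for `p`-forms `x`. -/
def IsLeibniz (d : Lam →ₗ[ℝ] Lam) : Prop :=
  ∀ (p : ℕ) (x y : Lam), x ∈ ⋀[ℝ]^p (Fin 6 → ℝ) →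
    d (x * y) = d x * y + ((-1 : ℝ) ^ p) • (x * d y)

theorem β_mul_self (i : Fin 6) : β i * β i = 0 :=
  ExteriorAlgebra.ι_sq_zero _

theorem β_mul_β_swap (i j : Fin 6) : β i * β j = -(β j * β i) :=
  eq_neg_of_add_eq_zero_left (ExteriorAlgebra.ι_add_mul_swap _ _)

theorem β_mem_exteriorPower_one (i : Fin 6) : β i ∈ ⋀[ℝ]^1 (Fin 6 → ℝ) := by
  rw [ExteriorAlgebra.exteriorPower, pow_one]
  exact LinearMap.mem_range_self _ _

/-- If `d` acts on `β i` and on `y` as multiplication by a multiple of `β 0`,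
then so it does on `β i ∧ y`, and the multiples add up. -/
theorem IsLeibniz.map_β_mul {d : Lam →ₗ[ℝ] Lam} (hd : IsLeibniz d) {i : Fin 6} {y : Lam}
    {a b : ℝ} (hi : d (β i) = a • (β 0 * β i)) (hy : d y = b • (β 0 * y)) :
    d (β i * y) = (a + b) • (β 0 * (β i * y)) := by
  rw [hd 1 _ _ (β_mem_exteriorPower_one i), hi, hy, mul_smul_comm, ← mul_assoc (β i),
    β_mul_β_swap i 0, add_smul, smul_mul_assoc, neg_mul, mul_assoc]
  simp

/-- Symplectic half-flat structure on the solvable Lie algebra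
`s₁ = (0,0,13,-14,15,-16)`: `F̂ = β¹² + β³⁴ + β⁵⁶` is closed and
`Ψ̂ = (β¹ + iβ²)(β³ + iβ⁴)(β⁵ + iβ⁶)` has closed real part; moreover the real
part `β¹` of the `(1,0)`-form `α̂ = β¹ + iβ²` is closed. -/
theorem s1_symplectic_half_flat
    (d : Lam →ₗ[ℝ] Lam) (hleib : IsLeibniz d)
    (h1 : d (β 0) = 0) (h2 : d (β 1) = 0)
    (h3 : d (β 2) = β 0 * β 2) (h4 : d (β 3) = -(β 0 * β 3))
    (h5 : d (β 4) = β 0 * β 4) (h6 : d (β 5) = -(β 0 * β 5)) :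
    d (β 0 * β 1 + β 2 * β 3 + β 4 * β 5) = 0 ∧
    d (reProd3 (β 0) (β 1) (β 2) (β 3) (β 4) (β 5)) = 0 ∧
    d (β 0) = 0 := by
  have w1 : d (β 0) = (0 : ℝ) • (β 0 * β 0) := by rw [h1, zero_smul]
  have w2 : d (β 1) = (0 : ℝ) • (β 0 * β 1) := by rw [h2, zero_smul]
  have w3 : d (β 2) = (1 : ℝ) • (β 0 * β 2) := by rw [h3, one_smul]
  have w4 : d (β 3) = (-1 : ℝ) • (β 0 * β 3) := by rw [h4, neg_one_smul]
  have w5 : d (β 4) = (1 : ℝ) • (β 0 * β 4) := by rw [h5, one_smul]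
  have w6 : d (β 5) = (-1 : ℝ) • (β 0 * β 5) := by rw [h6, neg_one_smul]
  have β_zero_mul (y : Lam) : β 0 * (β 0 * y) = 0 := by
    rw [← mul_assoc, β_mul_self, zero_mul]
  refine ⟨?_, ?_, h1⟩
  · rw [map_add, map_add, hleib.map_β_mul w1 w2, hleib.map_β_mul w3 w4, hleib.map_β_mul w5 w6]
    simp
  · simp only [reProd3, mul_assoc, map_sub]
    rw [hleib.map_β_mul w1 (hleib.map_β_mul w3 w5), hleib.map_β_mul w1 (hleib.map_β_mul w4 w6),
      hleib.map_β_mul w2 (hleib.map_β_mul w3 w6), hleib.map_β_mul w2 (hleib.map_β_mul w4 w5)]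
    simp [β_zero_mul]
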